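/- arXiv:1508.02471 — 2 statements merged into one kernel-verified Lean document; each statement's English description precedes it below -/
import Mathlib

section
/- (Proposition 3, Algorithm FastWithRelabeling.) Let w be a positive integer with w ≤ L, and let t be the smallest positive integer with C(t, w) ≥ L. In the exploration model, suppose each agent with label ℓ forms the t-bit string S which is the characteristic string of the lexicographically ℓ-th smallest w-element subset of {1,…,t} (subsets of {1,…,t} being ordered by the lexicographic order on their characteristic strings), forms T = (1, S_1, S_1, …, S_t, S_t) of length 2t+1, and executes the schedule whose i-th phase is an exploration phase if T_i = 1 and a waiting phase otherwise. Then for any distinct labels ℓ_A, ℓ_B ∈ {1,…,L}, any distinct starting nodes, and any delay τ ≥ 1, rendezvous is completed in time at most (4t + 5)·E, and the total cost is at most (4w + 2)·E. -/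
/-- Node reached at the start of phase `k` (phases numbered from 0, each lasting `E` rounds):
in an exploration phase (schedule value `true`) the agent follows `expl` for `E` steps;
in a waiting phase it stays put. -/
def startOfPhase {V : Type*} (expl : V → ℕ → V) (E : ℕ) (T : ℕ → Bool) (p : V) : ℕ → V
  | 0 => p
  | k + 1 => if T k then expl (startOfPhase expl E T p k) E else startOfPhase expl E T p k

/-- Position at round `t` of an agent with schedule `T`, starting node `p` and wake-up round `τ`:
before waking it sits at `p`; after waking it executes its phases, each lasting `E` rounds. -/
def agentPos {V : Type*} (expl : V → ℕ → V) (E : ℕ) (T : ℕ → Bool) (p : V) (τ t : ℕ) : V :=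
  if t < τ then p
  else if T ((t - τ) / E) then expl (startOfPhase expl E T p ((t - τ) / E)) ((t - τ) % E)
  else startOfPhase expl E T p ((t - τ) / E)

/-- The first round at which the two agents occupy the same node. -/
noncomputable def meetRound {V : Type*} (expl : V → ℕ → V) (E : ℕ) (TA TB : ℕ → Bool) (pA pB : V)
    (τA τB : ℕ) : ℕ :=
  sInf {t | agentPos expl E TA pA τA t = agentPos expl E TB pB τB t}

/-- Cost incurred by an agent by round `t`: the number of rounds up to round `t` that belong to
its exploration phases. -/
def agentCost (E : ℕ) (T : ℕ → Bool) (τ t : ℕ) : ℕ :=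
  ((Finset.range (t - τ)).filter fun s => T (s / E) = true).card

/-- The numeric value of a `t`-bit string read most-significant-bit first; lexicographic
order on `t`-bit strings coincides with the order of these values. -/
def strVal (t : ℕ) (S : Fin t → Bool) : ℕ :=
  ∑ i : Fin t, if S i then 2 ^ (t - 1 - i.val) else 0

/-- The number of 1's in a `t`-bit string (the size of the subset of `{1,…,t}` of which it is
the characteristic string). -/
def strOnes (t : ℕ) (S : Fin t → Bool) : ℕ := (Finset.univ.filter fun i => S i = true).card

/-- `S` is the characteristic string of the lexicographically `ℓ`-th smallest `w`-element
subset of `{1,…,t}`: it has exactly `w` ones, and exactly `ℓ - 1` strings with `w` ones are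
lexicographically smaller. -/
def IsNthSmallestString (t w ℓ : ℕ) (S : Fin t → Bool) : Prop :=
  strOnes t S = w ∧
    ((Finset.univ : Finset (Fin t → Bool)).filter
      fun S' => strOnes t S' = w ∧ strVal t S' < strVal t S).card = ℓ - 1

/-- Algorithm `FastWithRelabeling`: the schedule `T = (1, S₁, S₁, …, S_t, S_t)`; phase `k`
(numbered from 0) is an exploration phase iff the corresponding entry of `T` is 1 (after `T`
is exhausted, the agent waits). -/
def relabelSched (t : ℕ) (S : Fin t → Bool) : ℕ → Bool :=
  fun k => if k = 0 then true
    else if h : (k - 1) / 2 < t then S ⟨(k - 1) / 2, h⟩ else false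

section Positions

variable {V : Type*} {expl : V → ℕ → V} {E : ℕ} {T : ℕ → Bool} {p : V} {τ : ℕ}

theorem agentPos_of_le {t : ℕ} (ht : t ≤ τ) (hexpl0 : ∀ v, expl v 0 = v) :
    agentPos expl E T p τ t = p := by
  rcases ht.lt_or_eq with h | rfl
  · simp [agentPos, h]
  · simp [agentPos, startOfPhase, hexpl0]

theorem agentPos_phase_start (hE : 1 ≤ E) (hexpl0 : ∀ v, expl v 0 = v) (k : ℕ) :
    agentPos expl E T p τ (τ + k * E) = startOfPhase expl E T p k := by
  have hdiv : k * E / E = k := Nat.mul_div_cancel k hE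
  simp [agentPos, hdiv, hexpl0]

theorem agentPos_phase_interior {k i : ℕ} (hi : i < E) :
    agentPos expl E T p τ (τ + k * E + i) =
      if T k then expl (startOfPhase expl E T p k) i else startOfPhase expl E T p k := by
  have hsub : τ + k * E + i - τ = i + k * E := by omega
  have hdiv : (i + k * E) / E = k := by
    rw [Nat.add_mul_div_right _ _ (by omega), Nat.div_eq_of_lt hi, zero_add]
  have hmod : (i + k * E) % E = i := by
    rw [Nat.add_mul_mod_self_right, Nat.mod_eq_of_lt hi]
  have hlt : ¬ τ + k * E + i < τ := by omega
  simp only [agentPos, if_neg hlt, hsub, hdiv, hmod]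

theorem agentPos_phase (hE : 1 ≤ E) (hexpl0 : ∀ v, expl v 0 = v) {k i : ℕ} (hi : i ≤ E) :
    agentPos expl E T p τ (τ + k * E + i) =
      if T k then expl (startOfPhase expl E T p k) i else startOfPhase expl E T p k := by
  rcases hi.lt_or_eq with h | rfl
  · exact agentPos_phase_interior h
  · rw [add_assoc, ← Nat.succ_mul, agentPos_phase_start hE hexpl0]
    rfl

/-- An agent that waits in two consecutive phases does not move during either of them. -/
theorem agentPos_of_wait_two (hE : 1 ≤ E) (hexpl0 : ∀ v, expl v 0 = v) {k r : ℕ}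
    (h₀ : T k = false) (h₁ : T (k + 1) = false) (hr : τ + k * E ≤ r)
    (hr' : r ≤ τ + (k + 2) * E) :
    agentPos expl E T p τ r = startOfPhase expl E T p k := by
  rcases le_total r (τ + k * E + E) with h | h
  · obtain ⟨i, rfl⟩ := Nat.exists_eq_add_of_le hr
    rw [agentPos_phase hE hexpl0 (by omega), h₀, if_neg Bool.false_ne_true]
  · have hmul₁ : (k + 1) * E = k * E + E := by ring
    have hmul₂ : (k + 2) * E = k * E + E + E := by ring
    obtain ⟨i, rfl⟩ := Nat.exists_eq_add_of_le (show τ + (k + 1) * E ≤ r by omega)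
    rw [agentPos_phase hE hexpl0 (by omega), h₁, if_neg Bool.false_ne_true]
    simp [startOfPhase, h₀]

/-- An exploring agent reaches any given node by the end of the phase. -/
theorem exists_agentPos_eq_of_explore (hE : 1 ≤ E) (hexpl0 : ∀ v, expl v 0 = v)
    (hexplAll : ∀ v w : V, ∃ i ≤ E, expl v i = w) {k : ℕ} (hk : T k = true) (q : V) :
    ∃ r, τ + k * E ≤ r ∧ r ≤ τ + (k + 1) * E ∧ agentPos expl E T p τ r = q := by
  obtain ⟨i, hi, hq⟩ := hexplAll (startOfPhase expl E T p k) q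
  refine ⟨τ + k * E + i, by omega, ?_, ?_⟩
  · rw [Nat.succ_mul]
    omega
  · rw [agentPos_phase hE hexpl0 hi, if_pos hk, hq]

end Positions

section Cost

variable {t : ℕ}

theorem agentCost_le {E : ℕ} (hE : 1 ≤ E) {T : ℕ → Bool} {K : Finset ℕ}
    (hK : ∀ k, T k = true → k ∈ K) (τ n : ℕ) : agentCost E T τ n ≤ E * K.card := by
  refine Finset.card_le_mul_card_image_of_maps_to (f := fun s => s / E)
    (fun s hs => hK _ (Finset.mem_filter.mp hs).2) E fun k _ => ?_
  calc _ ≤ (Finset.Ico (k * E) (k * E + E)).card := by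
        refine Finset.card_le_card fun s hs => ?_
        have hk : s / E = k := (Finset.mem_filter.mp hs).2
        have hdiv := Nat.div_add_mod' s E
        have hmod := Nat.mod_lt s hE
        rw [hk] at hdiv
        exact Finset.mem_Ico.mpr (by omega)
    _ = E := by simp

theorem relabelSched_odd (S : Fin t → Bool) (i : Fin t) :
    relabelSched t S (2 * i + 1) = S i := by
  simp [relabelSched]

theorem relabelSched_even (S : Fin t → Bool) (i : Fin t) :
    relabelSched t S (2 * i + 2) = S i := by
  have h : (2 * (i : ℕ) + 1) / 2 = i := by omega
  simp [relabelSched, h]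

/-- A superset of the exploration phases of `relabelSched`. -/
def explorePhases (S : Fin t → Bool) : Finset ℕ :=
  let ones := Finset.univ.filter fun i => S i = true
  insert 0 (ones.image (fun i : Fin t => 2 * (i : ℕ) + 1) ∪
    ones.image (fun i : Fin t => 2 * (i : ℕ) + 2))

theorem mem_explorePhases {S : Fin t → Bool} {k : ℕ} (hk : relabelSched t S k = true) :
    k ∈ explorePhases S := by
  rcases Nat.eq_zero_or_pos k with rfl | hpos
  · simp [explorePhases]
  · by_cases h : (k - 1) / 2 < t
    · have hS : S ⟨(k - 1) / 2, h⟩ = true := by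
        simpa [relabelSched, hpos.ne', h] using hk
      refine Finset.mem_insert_of_mem (Finset.mem_union.mpr ?_)
      rcases Nat.mod_two_eq_zero_or_one (k - 1) with hm | hm
      · exact Or.inl (Finset.mem_image.mpr ⟨⟨_, h⟩, by simpa using hS, by dsimp only; omega⟩)
      · exact Or.inr (Finset.mem_image.mpr ⟨⟨_, h⟩, by simpa using hS, by dsimp only; omega⟩)
    · simp [relabelSched, hpos.ne', h] at hk

theorem card_explorePhases_le (S : Fin t → Bool) :
    (explorePhases S).card ≤ 2 * strOnes t S + 1 := by
  refine (Finset.card_insert_le _ _).trans (Nat.succ_le_succ ?_)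
  refine (Finset.card_union_le _ _).trans ?_
  rw [two_mul]
  exact add_le_add Finset.card_image_le Finset.card_image_le

theorem agentCost_relabelSched_le {E : ℕ} (hE : 1 ≤ E) (S : Fin t → Bool) (τ n : ℕ) :
    agentCost E (relabelSched t S) τ n ≤ (2 * strOnes t S + 1) * E :=
  (agentCost_le hE (fun _ => mem_explorePhases) τ n).trans <| by
    rw [mul_comm]
    exact Nat.mul_le_mul_right E (card_explorePhases_le S)

end Cost

theorem IsNthSmallestString.eq_of_same {t w ℓ ℓ' : ℕ} {S : Fin t → Bool}
    (h : IsNthSmallestString t w ℓ S) (h' : IsNthSmallestString t w ℓ' S)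
    (hℓ : 1 ≤ ℓ) (hℓ' : 1 ≤ ℓ') : ℓ = ℓ' := by
  have := h.2.symm.trans h'.2
  omega

theorem exists_meeting_relabelSched {V : Type*} {E : ℕ} (hE : 1 ≤ E) {expl : V → ℕ → V}
    (hexpl0 : ∀ v, expl v 0 = v) (hexplAll : ∀ v w : V, ∃ i ≤ E, expl v i = w)
    {t : ℕ} {SA SB : Fin t → Bool} (hne : SA ≠ SB) (pA pB : V) {τ : ℕ} (hτ : 1 ≤ τ) :
    ∃ r ≤ 1 + (2 * t + 1) * E, agentPos expl E (relabelSched t SA) pA 1 r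
        = agentPos expl E (relabelSched t SB) pB τ r := by
  rcases lt_or_ge E τ with hlate | hearly
  · obtain ⟨r, -, hr, hpos⟩ := exists_agentPos_eq_of_explore (p := pA) (τ := 1) hE hexpl0 hexplAll
      (show relabelSched t SA 0 = true from rfl) pB
    refine ⟨r, ?_, ?_⟩
    · exact hr.trans (by gcongr; omega)
    · rw [hpos, agentPos_of_le (by omega) hexpl0]
  · obtain ⟨i, hi⟩ := Function.ne_iff.mp hne
    have hbound : (2 * (i : ℕ) + 3) * E ≤ (2 * t + 1) * E :=
      Nat.mul_le_mul_right E (by omega)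
    have hmul₁ : (2 * (i : ℕ) + 2) * E = (2 * i + 1) * E + E := by ring
    have hmul₂ : (2 * (i : ℕ) + 3) * E = (2 * i + 1) * E + E + E := by ring
    have hassoc₁ : 2 * (i : ℕ) + 1 + 1 = 2 * i + 2 := rfl
    have hassoc₂ : 2 * (i : ℕ) + 2 + 1 = 2 * i + 3 := rfl
    have hassoc₃ : 2 * (i : ℕ) + 1 + 2 = 2 * i + 3 := rfl
    rcases hA : SA i with _ | _
    · have hB : SB i = true := by simpa [hA] using hi
      obtain ⟨r, hr₁, hr₂, hpos⟩ := exists_agentPos_eq_of_explore (p := pB) (τ := τ) hE hexpl0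
        hexplAll ((relabelSched_odd SB i).trans hB)
        (startOfPhase expl E (relabelSched t SA) pA (2 * i + 1))
      rw [hassoc₁] at hr₂
      refine ⟨r, by omega, ?_⟩
      rw [hpos, agentPos_of_wait_two hE hexpl0 ((relabelSched_odd SA i).trans hA)
        ((relabelSched_even SA i).trans hA) (by omega) (by rw [hassoc₃]; omega)]
    · have hB : SB i = false := by simpa [hA] using hi
      obtain ⟨r, hr₁, hr₂, hpos⟩ := exists_agentPos_eq_of_explore (p := pA) (τ := 1) hE hexpl0
        hexplAll ((relabelSched_even SA i).trans hA)
        (startOfPhase expl E (relabelSched t SB) pB (2 * i + 1))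
      rw [hassoc₂] at hr₂
      refine ⟨r, by omega, ?_⟩
      rw [hpos, agentPos_of_wait_two hE hexpl0 ((relabelSched_odd SB i).trans hB)
        ((relabelSched_even SB i).trans hB) (by omega) (by rw [hassoc₃]; omega)]

/-- Proposition 3 (Algorithm `FastWithRelabeling`): with `w ≤ L` and `t` the smallest positive
integer with `C(t,w) ≥ L`, rendezvous is completed in time at most `(4t+5)·E` and at total
cost at most `(4w+2)·E`. -/
theorem fastWithRelabeling_rendezvous {V : Type*} [Fintype V] [Nonempty V] (E : ℕ) (hE : 1 ≤ E)
    (expl : V → ℕ → V) (hexpl0 : ∀ v, expl v 0 = v)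
    (hexplAll : ∀ v w : V, ∃ i ≤ E, expl v i = w)
    (L w t : ℕ) (hw : 1 ≤ w) (hwL : w ≤ L)
    (ht : 0 < t) (htL : L ≤ Nat.choose t w)
    (htmin : ∀ t', 0 < t' → L ≤ Nat.choose t' w → t ≤ t')
    (ℓA ℓB : ℕ) (hℓA : ℓA ∈ Finset.Icc 1 L) (hℓB : ℓB ∈ Finset.Icc 1 L) (hne : ℓA ≠ ℓB)
    (SA SB : Fin t → Bool)
    (hSA : IsNthSmallestString t w ℓA SA) (hSB : IsNthSmallestString t w ℓB SB)
    (pA pB : V) (hp : pA ≠ pB) (τ : ℕ) (hτ : 1 ≤ τ) :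
    (∃ r, agentPos expl E (relabelSched t SA) pA 1 r
        = agentPos expl E (relabelSched t SB) pB τ r) ∧
    meetRound expl E (relabelSched t SA) (relabelSched t SB) pA pB 1 τ ≤ (4 * t + 5) * E ∧
    agentCost E (relabelSched t SA) 1
        (meetRound expl E (relabelSched t SA) (relabelSched t SB) pA pB 1 τ)
      + agentCost E (relabelSched t SB) τ
        (meetRound expl E (relabelSched t SA) (relabelSched t SB) pA pB 1 τ)
      ≤ (4 * w + 2) * E := by
  have hS : SA ≠ SB := by
    rintro rfl
    exact hne (hSA.eq_of_same hSB (Finset.mem_Icc.mp hℓA).1 (Finset.mem_Icc.mp hℓB).1)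
  obtain ⟨r, hr, hmeet⟩ := exists_meeting_relabelSched hE hexpl0 hexplAll hS pA pB hτ
  refine ⟨⟨r, hmeet⟩, (Nat.sInf_le hmeet).trans (hr.trans (by nlinarith)), ?_⟩
  refine (add_le_add (agentCost_relabelSched_le hE SA _ _)
    (agentCost_relabelSched_le hE SB _ _)).trans (le_of_eq ?_)
  rw [hSA.1, hSB.1]
  ring
end

section
/- Let Prog be the progress vector of Agg, and suppose 1 ≤ i₁ ≤ i₂ ≤ M are such that Prog i = 0 for all i ∈ {i₁,…,i₂}, and moreover i₁ = 1 or Prog(i₁−1) ≠ 0, and i₂ = M or Prog(i₂+1) ≠ 0 (i.e., Prog[i₁…i₂] is a maximal run of zeros in Prog). Then: (1) |surplus(i₁, i)| ≤ 1 for every i ∈ {i₁,…,i₂}; and (2) if i₂ ≠ M, then surplus(i₁, i₂) = 0. -/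
/-- `surplus Agg s i = Σ_{j=s}^{i} Agg j`. -/
def surplus (Agg : ℕ → ℤ) (s i : ℕ) : ℤ := ∑ j ∈ Finset.Icc s i, Agg j

/-- The list of pairs `(a, b)` produced by the while-loop of the progress-vector procedure,
started at index `s`: while `s ≤ M` and some `k ∈ {s,…,M}` has `|surplus(s,k)| = 2`, let `b`
be the smallest such `k`, let `a` be the smallest index in `{s,…,b}` with `|surplus(s,i)| ≥ 1`
for all `i ∈ {a,…,b}`, record `(a, b)` and continue from `s := b + 1`. -/
def progPairs (Agg : ℕ → ℤ) (M : ℕ) (s : ℕ) : List (ℕ × ℕ) :=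
  if h : ∃ k, k ∈ Finset.Icc s M ∧ |surplus Agg s k| = 2 then
    let b := Nat.find h
    have hb := Nat.find_spec h
    have hex : ∃ a, s ≤ a ∧ ∀ i ∈ Finset.Icc a b, 1 ≤ |surplus Agg s i| := by
      refine ⟨b, (Finset.mem_Icc.mp hb.1).1, ?_⟩
      intro i hi
      rw [Finset.mem_Icc] at hi
      have hib : i = b := le_antisymm hi.2 hi.1
      rw [hib, hb.2]
      norm_num
    let a := Nat.find hex
    (a, b) :: progPairs Agg M (b + 1)
  else []
  termination_by M + 1 - s
  decreasing_by
    have hb := Nat.find_spec h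
    have h1 := Finset.mem_Icc.mp hb.1
    omega

/-- The progress vector of `Agg` (over indices `1,…,M`): entries at the recorded indices
`a`, `b` of each iteration are set to `Agg b`; all other entries are 0. -/
def progVec (Agg : ℕ → ℤ) (M : ℕ) (i : ℕ) : ℤ :=
  match (progPairs Agg M 1).find? (fun p => p.1 == i || p.2 == i) with
  | some p => Agg p.2
  | none => 0

theorem surplus_of_lt (Agg : ℕ → ℤ) {s i : ℕ} (h : i < s) : surplus Agg s i = 0 := by
  simp [surplus, Finset.Icc_eq_empty_of_lt h]

theorem surplus_succ (Agg : ℕ → ℤ) {s i : ℕ} (h : s ≤ i + 1) :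
    surplus Agg s (i + 1) = surplus Agg s i + Agg (i + 1) :=
  Finset.sum_Icc_succ_top h Agg

theorem surplus_add_surplus (Agg : ℕ → ℤ) {s a i : ℕ} (hs : s ≤ a + 1) (ha : a ≤ i) :
    surplus Agg s a + surplus Agg (a + 1) i = surplus Agg s i := by
  induction i, ha using Nat.le_induction with
  | base => simp [surplus_of_lt]
  | succ n hn ih => rw [surplus_succ Agg (by omega), surplus_succ Agg (by omega), ← ih, add_assoc]

/-- Since consecutive surpluses differ by at most `1`, they stay in `{-1, 0, 1}` until the first
time one of them has absolute value `2`. -/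
theorem abs_surplus_le_one {Agg : ℕ → ℤ} (hAgg : ∀ i, Agg i = -1 ∨ Agg i = 0 ∨ Agg i = 1)
    {s n : ℕ} (hs : 1 ≤ s) (h : ∀ k, s ≤ k → k < n → |surplus Agg s k| ≠ 2) :
    ∀ k, k < n → |surplus Agg s k| ≤ 1 := by
  intro k
  induction k with
  | zero => intro _; simp [surplus_of_lt Agg (show 0 < s by omega)]
  | succ k ih =>
    intro hk
    rcases Nat.lt_or_ge (k + 1) s with hks | hks
    · simp [surplus_of_lt Agg hks]
    · have hne := h (k + 1) hks hk
      have hle := ih (by omega)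
      rw [surplus_succ Agg hks] at hne ⊢
      rcases hAgg (k + 1) with e | e | e <;> rw [e] at hne ⊢ <;> grind

/-- `(a, b)` is the pair recorded by an iteration of the progress-vector procedure started
at `s`. -/
structure IsProgPair (Agg : ℕ → ℤ) (M s a b : ℕ) : Prop where
  le_left : s ≤ a
  left_le_right : a ≤ b
  right_le : b ≤ M
  abs_right : |surplus Agg s b| = 2
  abs_ne_two : ∀ k, s ≤ k → k < b → |surplus Agg s k| ≠ 2
  one_le_abs : ∀ i, a ≤ i → i ≤ b → 1 ≤ |surplus Agg s i|
  surplus_pred : s < a → surplus Agg s (a - 1) = 0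

theorem progPairs_cases (Agg : ℕ → ℤ) (M s : ℕ) :
    (progPairs Agg M s = [] ∧ ∀ k, s ≤ k → k ≤ M → |surplus Agg s k| ≠ 2) ∨
    ∃ a b, progPairs Agg M s = (a, b) :: progPairs Agg M (b + 1) ∧ IsProgPair Agg M s a b := by
  by_cases h : ∃ k, k ∈ Finset.Icc s M ∧ |surplus Agg s k| = 2
  · right
    have hb := Nat.find_spec h
    have hbs := Finset.mem_Icc.mp hb.1
    have hb' : ∀ i ∈ Finset.Icc (Nat.find h) (Nat.find h), 1 ≤ |surplus Agg s i| := by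
      intro i hi
      rw [Finset.Icc_self, Finset.mem_singleton] at hi
      rw [hi, hb.2]
      norm_num
    have hex : ∃ a, s ≤ a ∧ ∀ i ∈ Finset.Icc a (Nat.find h), 1 ≤ |surplus Agg s i| :=
      ⟨Nat.find h, hbs.1, hb'⟩
    have ha := Nat.find_spec hex
    refine ⟨Nat.find hex, Nat.find h, ?_, ha.1, Nat.find_min' hex ⟨hbs.1, hb'⟩, hbs.2, hb.2, ?_,
      fun i h₁ h₂ => ha.2 i (Finset.mem_Icc.mpr ⟨h₁, h₂⟩), ?_⟩
    · rw [progPairs, dif_pos h]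
    · intro k hsk hkb hk
      exact Nat.find_min h hkb ⟨Finset.mem_Icc.mpr ⟨hsk, by omega⟩, hk⟩
    · intro hsa
      by_contra hne
      refine Nat.find_min hex (m := Nat.find hex - 1) (by omega) ⟨by omega, fun i hi => ?_⟩
      rw [Finset.mem_Icc] at hi
      rcases Nat.lt_or_ge i (Nat.find hex) with hlt | hge
      · rw [show i = Nat.find hex - 1 by omega]
        exact Int.one_le_abs hne
      · exact ha.2 i (Finset.mem_Icc.mpr ⟨hge, hi.2⟩)
  · left
    refine ⟨by rw [progPairs, dif_neg h], fun k h₁ h₂ hk => h ⟨k, Finset.mem_Icc.mpr ⟨h₁, h₂⟩, hk⟩⟩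

namespace IsProgPair

variable {Agg : ℕ → ℤ} {M s a b : ℕ}

theorem agg_right_ne_zero (h : IsProgPair Agg M s a b)
    (hAgg : ∀ i, Agg i = -1 ∨ Agg i = 0 ∨ Agg i = 1) (hs : 1 ≤ s) : Agg b ≠ 0 := by
  intro h0
  have hsb := h.le_left.trans h.left_le_right
  obtain ⟨c, rfl⟩ : ∃ c, b = c + 1 := ⟨b - 1, by omega⟩
  have hle := abs_surplus_le_one hAgg hs h.abs_ne_two c (by omega)
  have h2 := h.abs_right
  rw [surplus_succ Agg hsb, h0, add_zero] at h2
  omega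

theorem surplus_left_sub_one (h : IsProgPair Agg M s a b) (hs : 1 ≤ s) :
    surplus Agg s (a - 1) = 0 := by
  rcases h.le_left.lt_or_eq with hlt | rfl
  · exact h.surplus_pred hlt
  · exact surplus_of_lt Agg (by omega)

/-- Between the two recorded indices the surplus does not change. -/
theorem surplus_eq (h : IsProgPair Agg M s a b)
    (hAgg : ∀ i, Agg i = -1 ∨ Agg i = 0 ∨ Agg i = 1) (hs : 1 ≤ s) {i : ℕ} (hai : a ≤ i)
    (hib : i < b) : surplus Agg s i = surplus Agg s a := by
  have hsa := h.le_left
  induction i, hai using Nat.le_induction with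
  | base => rfl
  | succ n hn ih =>
    have l₁ := abs_surplus_le_one hAgg hs h.abs_ne_two n (by omega)
    have l₂ := abs_surplus_le_one hAgg hs h.abs_ne_two (n + 1) hib
    have g₁ := h.one_le_abs n hn (by omega)
    have g₂ := h.one_le_abs (n + 1) (by omega) hib.le
    rw [← ih (by omega)]
    rw [surplus_succ Agg (by omega)] at l₂ g₂ ⊢
    rcases hAgg (n + 1) with e | e | e <;> rw [e] at l₂ g₂ ⊢ <;> grind

end IsProgPair

theorem le_and_agg_ne_zero_of_mem_progPairs {Agg : ℕ → ℤ}
    (hAgg : ∀ i, Agg i = -1 ∨ Agg i = 0 ∨ Agg i = 1) {M s : ℕ} (hs : 1 ≤ s) {p : ℕ × ℕ}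
    (hp : p ∈ progPairs Agg M s) : s ≤ p.1 ∧ s ≤ p.2 ∧ Agg p.2 ≠ 0 := by
  induction hn : M + 1 - s using Nat.strong_induction_on generalizing s with
  | _ n ih =>
    rcases progPairs_cases Agg M s with ⟨hnil, -⟩ | ⟨a, b, hcons, h⟩
    · simp [hnil] at hp
    · have hsa := h.le_left
      have hab := h.left_le_right
      have hbM := h.right_le
      rw [hcons, List.mem_cons] at hp
      rcases hp with rfl | hp
      · exact ⟨hsa, hsa.trans hab, h.agg_right_ne_zero hAgg hs⟩
      · obtain ⟨h₁, h₂, h₃⟩ := ih _ (by omega) (by omega) hp rfl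
        exact ⟨by omega, by omega, h₃⟩

theorem progVec_ne_zero_iff {Agg : ℕ → ℤ} (hAgg : ∀ i, Agg i = -1 ∨ Agg i = 0 ∨ Agg i = 1)
    (M i : ℕ) : progVec Agg M i ≠ 0 ↔ ∃ p ∈ progPairs Agg M 1, p.1 = i ∨ p.2 = i := by
  unfold progVec
  split
  · next p hp =>
    have hmem := List.mem_of_find?_eq_some hp
    have hpi := List.find?_some hp
    simp only [Bool.or_eq_true, beq_iff_eq] at hpi
    exact iff_of_true (le_and_agg_ne_zero_of_mem_progPairs hAgg le_rfl hmem).2.2 ⟨p, hmem, hpi⟩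
  · next hnone =>
    rw [List.find?_eq_none] at hnone
    simpa using hnone

/-- The statement about maximal runs of zeros, for the procedure started at an arbitrary `s`. -/
theorem surplus_of_maximal_gap {Agg : ℕ → ℤ}
    (hAgg : ∀ i, Agg i = -1 ∨ Agg i = 0 ∨ Agg i = 1) {M s i₁ i₂ : ℕ} (hs : 1 ≤ s)
    (hsi : s ≤ i₁) (h12 : i₁ ≤ i₂) (h2 : i₂ ≤ M)
    (hzero : ∀ p ∈ progPairs Agg M s, ∀ i, i₁ ≤ i → i ≤ i₂ → p.1 ≠ i ∧ p.2 ≠ i)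
    (hleft : i₁ = s ∨ ∃ p ∈ progPairs Agg M s, p.1 = i₁ - 1 ∨ p.2 = i₁ - 1)
    (hright : i₂ = M ∨ ∃ p ∈ progPairs Agg M s, p.1 = i₂ + 1 ∨ p.2 = i₂ + 1) :
    (∀ i, i₁ ≤ i → i ≤ i₂ → |surplus Agg i₁ i| ≤ 1) ∧ (i₂ ≠ M → surplus Agg i₁ i₂ = 0) := by
  induction hn : M + 1 - s using Nat.strong_induction_on generalizing s with
  | _ n ih =>
    rcases progPairs_cases Agg M s with ⟨hnil, hne⟩ | ⟨a, b, hcons, h⟩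
    · simp only [hnil, List.not_mem_nil, false_and, exists_false, or_false] at hleft hright
      subst hleft hright
      exact ⟨fun i _ hi => abs_surplus_le_one hAgg hs
        (fun k h₁ h₂ => hne k h₁ (Nat.le_of_lt_succ h₂)) i (Nat.lt_succ_of_le hi),
        fun hM => absurd rfl hM⟩
    have hsa := h.le_left
    have hab := h.left_le_right
    have hbM := h.right_le
    have hlt : M + 1 - (b + 1) < n := by omega
    have hrest : ∀ p ∈ progPairs Agg M (b + 1), b + 1 ≤ p.1 ∧ b + 1 ≤ p.2 := fun p hp =>
      have := le_and_agg_ne_zero_of_mem_progPairs hAgg (by omega) hp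
      ⟨this.1, this.2.1⟩
    simp only [hcons, List.mem_cons, exists_eq_or_imp, forall_eq_or_imp] at hzero hleft hright
    obtain ⟨hzero, hzero'⟩ := hzero
    rcases Nat.lt_or_ge b i₁ with hbi | hbi
    · refine ih _ hlt (Nat.succ_pos b) hbi hzero' ?_ ?_ rfl
      · rcases hleft with e | e | e
        · omega
        · omega
        · exact Or.inr e
      · rcases hright with e | e | e
        · exact Or.inl e
        · omega
        · exact Or.inr e
    have hib : i₂ < b := by
      by_contra hc
      exact (hzero b hbi (by omega)).2 rfl
    have hl : i₁ = s ∨ a = i₁ - 1 := by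
      rcases hleft with e | e | ⟨p, hp, e⟩
      · exact Or.inl e
      · omega
      · have := hrest p hp
        omega
    have hr : a = i₂ + 1 ∨ b = i₂ + 1 := by
      rcases hright with e | e | ⟨p, hp, e⟩
      · omega
      · exact e
      · have := hrest p hp
        omega
    by_cases hi : i₁ = s
    · subst hi
      have hia : i₂ < a := by
        by_contra hc
        exact (hzero a hsa (by omega)).1 rfl
      refine ⟨fun i _ hi => abs_surplus_le_one hAgg hs h.abs_ne_two i (by omega), fun _ => ?_⟩
      rw [show i₂ = a - 1 by omega]
      exact h.surplus_left_sub_one hs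
    · obtain rfl : i₁ = a + 1 := by omega
      have hz : ∀ i, a + 1 ≤ i → i ≤ i₂ → surplus Agg (a + 1) i = 0 := fun i h₁ h₂ => by
        have := surplus_add_surplus Agg (show s ≤ a + 1 by omega) (show a ≤ i by omega)
        rw [h.surplus_eq hAgg hs (by omega) (by omega : i < b)] at this
        omega
      exact ⟨fun i h₁ h₂ => by simp [hz i h₁ h₂], fun _ => hz i₂ h12 le_rfl⟩

/-- Properties of maximal runs of zeros in the progress vector: if `Prog[i₁…i₂]` is a maximal
run of zeros, then every surplus `surplus(i₁, i)` for `i ∈ {i₁,…,i₂}` has absolute value at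
most 1, and if `i₂ ≠ M` then `surplus(i₁, i₂) = 0`. -/
theorem progVec_zero_run (M : ℕ) (hM : 1 ≤ M) (Agg : ℕ → ℤ)
    (hAgg : ∀ i, Agg i = -1 ∨ Agg i = 0 ∨ Agg i = 1)
    (i₁ i₂ : ℕ) (h1 : 1 ≤ i₁) (h12 : i₁ ≤ i₂) (h2 : i₂ ≤ M)
    (hzero : ∀ i, i₁ ≤ i → i ≤ i₂ → progVec Agg M i = 0)
    (hleft : i₁ = 1 ∨ progVec Agg M (i₁ - 1) ≠ 0)
    (hright : i₂ = M ∨ progVec Agg M (i₂ + 1) ≠ 0) :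
    (∀ i, i₁ ≤ i → i ≤ i₂ → |surplus Agg i₁ i| ≤ 1) ∧
    (i₂ ≠ M → surplus Agg i₁ i₂ = 0) := by
  simp only [progVec_ne_zero_iff hAgg] at hleft hright
  refine surplus_of_maximal_gap hAgg le_rfl h1 h12 h2 (fun p hp i hi hi' => ?_) hleft hright
  have hnot := (progVec_ne_zero_iff hAgg M i).not.mp (not_not.mpr (hzero i hi hi'))
  exact not_or.mp fun e => hnot ⟨p, hp, e⟩
end
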